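/- arXiv:0911.0859 — 2 statements merged into one kernel-verified Lean document; each statement's English description precedes it below -/
import Mathlib

section
/- Let I be a zero-dimensional ideal and O a degree-compatible order ideal of I. Then the conditions (a) |O^{=i}| = dim⟨T^n_{=i}⟩ − dim(I^{≤i}/I^{≤i−1}) for all i together with (b) ⟨O^{=i}⟩ ∩ (image of I^{≤i} in ⟨T^n_{=i}⟩) = {0} for all i, are jointly equivalent to: (a) plus K[X] = I ⊕ ⟨O⟩ as vector spaces. -/
open MvPolynomial

namespace MvPolynomial

variable {σ K : Type*} [Field K]

lemma totalDegree_le_iff_forall_homogeneousComponent_eq_zero {p : MvPolynomial σ K} {d : ℕ} :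
    p.totalDegree ≤ d ↔ ∀ k, d < k → homogeneousComponent k p = 0 := by
  refine ⟨fun h k hk => homogeneousComponent_eq_zero _ _ (h.trans_lt hk), fun h => ?_⟩
  refine Finset.sup_le fun m hm => ?_
  by_contra! hlt
  have h0 := congrArg (coeff m) (h m.degree hlt)
  rw [coeff_homogeneousComponent, if_pos rfl, coeff_zero] at h0
  exact mem_support_iff.1 hm h0

lemma eq_zero_of_forall_homogeneousComponent_eq_zero {p : MvPolynomial σ K}
    (h : ∀ k, homogeneousComponent k p = 0) : p = 0 := by
  rw [← sum_homogeneousComponent p]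
  exact Finset.sum_eq_zero fun k _ => h k

/-- The degree `i` leading forms of the elements of `I` of total degree at most `i`. -/
noncomputable def leadingForms (I : Submodule K (MvPolynomial σ K)) (i : ℕ) :
    Submodule K (MvPolynomial σ K) :=
  Submodule.map (homogeneousComponent i) (I ⊓ restrictTotalDegree σ K i)

lemma mem_leadingForms {I : Submodule K (MvPolynomial σ K)} {i : ℕ} {f : MvPolynomial σ K} :
    f ∈ leadingForms I i ↔
      ∃ p ∈ I, (∀ k, i < k → homogeneousComponent k p = 0) ∧ homogeneousComponent i p = f := by
  simp only [leadingForms, Submodule.mem_map, Submodule.mem_inf, mem_restrictTotalDegree,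
    totalDegree_le_iff_forall_homogeneousComponent_eq_zero, and_assoc]

lemma leadingForms_le_homogeneousSubmodule (I : Submodule K (MvPolynomial σ K)) (i : ℕ) :
    leadingForms I i ≤ homogeneousSubmodule σ K i := by
  rintro _ ⟨p, -, rfl⟩
  exact homogeneousComponent_mem i p

lemma mem_restrictSupport {s : Set (σ →₀ ℕ)} {p : MvPolynomial σ K} :
    p ∈ restrictSupport K s ↔ ∀ m, coeff m p ≠ 0 → m ∈ s := by
  rw [mem_restrictSupport_iff]
  exact ⟨fun h m hm => h (mem_support_iff.2 hm), fun h m hm => h m (mem_support_iff.1 hm)⟩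

lemma homogeneousComponent_mem_restrictSupport {s : Set (σ →₀ ℕ)} {p : MvPolynomial σ K}
    (hp : p ∈ restrictSupport K s) (i : ℕ) :
    homogeneousComponent i p ∈ restrictSupport K {m | m ∈ s ∧ m.degree = i} := by
  rw [mem_restrictSupport] at hp ⊢
  intro m hm
  rw [coeff_homogeneousComponent] at hm
  split_ifs at hm with h
  · exact ⟨hp m hm, h⟩
  · exact absurd rfl hm

lemma restrictSupport_degree_le_homogeneousSubmodule (s : Set (σ →₀ ℕ)) (i : ℕ) :
    restrictSupport K {m | m ∈ s ∧ m.degree = i} ≤ homogeneousSubmodule σ K i := by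
  rw [homogeneousSubmodule_eq_finsupp_supported]
  exact restrictSupport_mono K fun m hm => hm.2

lemma finrank_restrictSupport_coe (s : Finset (σ →₀ ℕ)) :
    Module.finrank K (restrictSupport K (s : Set (σ →₀ ℕ))) = s.card := by
  rw [Module.finrank_eq_nat_card_basis (basisRestrictSupport K (s : Set (σ →₀ ℕ)))]
  simp

/-- If the leading forms of `I` and the monomials in `s` span each homogeneous part of degree
less than `d`, then `I` and the monomials in `s` span all polynomials of degree less than `d`,
with the summand in `I` again of degree less than `d`. -/
lemma exists_sub_mem_restrictSupport {I : Submodule K (MvPolynomial σ K)}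
    {s : Set (σ →₀ ℕ)} (d : ℕ)
    (h : ∀ j < d, homogeneousSubmodule σ K j ≤
      restrictSupport K {m | m ∈ s ∧ m.degree = j} ⊔ leadingForms I j)
    (p : MvPolynomial σ K) (hp : ∀ k, d ≤ k → homogeneousComponent k p = 0) :
    ∃ q ∈ I, (∀ k, d ≤ k → homogeneousComponent k q = 0) ∧ p - q ∈ restrictSupport K s := by
  induction d generalizing p with
  | zero =>
    obtain rfl := eq_zero_of_forall_homogeneousComponent_eq_zero fun k => hp k k.zero_le
    exact ⟨0, I.zero_mem, by simp, by simp⟩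
  | succ d ih =>
    obtain ⟨o, ho, w, hw, how⟩ := Submodule.mem_sup.1
      (h d d.lt_succ_self (homogeneousComponent_mem d p))
    obtain ⟨r, hrI, hr, hrw⟩ := mem_leadingForms.1 hw
    have hoh := restrictSupport_degree_le_homogeneousSubmodule s d ho
    have hos : o ∈ restrictSupport K s := restrictSupport_mono K (fun m hm => hm.1) ho
    obtain ⟨q, hqI, hq, hqs⟩ := ih (fun j hj => h j (hj.trans d.lt_succ_self)) (p - o - r) (by
      intro k hk
      rw [map_sub, map_sub, homogeneousComponent_of_mem hoh]
      rcases hk.eq_or_lt with rfl | hk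
      · rw [if_pos rfl, hrw, ← how]
        abel
      · rw [if_neg hk.ne', hp k hk, hr k hk]
        simp)
    refine ⟨q + r, I.add_mem hqI hrI, fun k hk => ?_, ?_⟩
    · rw [map_add, hq k (Nat.le_of_succ_le hk), hr k hk, add_zero]
    · have := add_mem hqs hos
      rwa [show p - o - r - q + o = p - (q + r) by abel] at this

/-- If no nonzero leading form of `I` is supported in `s`, then neither is any nonzero element
of `I`. -/
lemma inf_restrictSupport_eq_bot {I : Submodule K (MvPolynomial σ K)} {s : Set (σ →₀ ℕ)}
    (h : ∀ i, restrictSupport K {m | m ∈ s ∧ m.degree = i} ⊓ leadingForms I i = ⊥) :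
    I ⊓ restrictSupport K s = ⊥ := by
  refine (Submodule.eq_bot_iff _).2 fun p ⟨hpI, hps⟩ => ?_
  suffices H : ∀ d, (∀ k, d ≤ k → homogeneousComponent k p = 0) → p = 0 from
    H (p.totalDegree + 1) fun k hk => homogeneousComponent_eq_zero _ _ hk
  intro d
  induction d with
  | zero => exact fun hd => eq_zero_of_forall_homogeneousComponent_eq_zero fun k => hd k k.zero_le
  | succ d ih =>
    intro hd
    refine ih fun k hk => ?_
    rcases hk.eq_or_lt with rfl | hk
    · rw [← Submodule.mem_bot K, ← h]
      exact ⟨homogeneousComponent_mem_restrictSupport hps _, mem_leadingForms.2 ⟨p, hpI, hd, rfl⟩⟩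
    · exact hd k hk

lemma sup_restrictSupport_eq_top {I : Submodule K (MvPolynomial σ K)} {s : Set (σ →₀ ℕ)}
    (h : ∀ i, homogeneousSubmodule σ K i ≤
      restrictSupport K {m | m ∈ s ∧ m.degree = i} ⊔ leadingForms I i) :
    I ⊔ restrictSupport K s = ⊤ := by
  refine eq_top_iff.2 fun p _ => ?_
  obtain ⟨q, hqI, -, hqs⟩ := exists_sub_mem_restrictSupport (p.totalDegree + 1)
    (fun j _ => h j) p fun k hk => homogeneousComponent_eq_zero _ _ hk
  exact Submodule.mem_sup.2 ⟨q, hqI, p - q, hqs, add_sub_cancel q p⟩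

lemma homogeneousSubmodule_le_of_inf_eq_bot [Finite σ] {I : Submodule K (MvPolynomial σ K)}
    {s : Set (σ →₀ ℕ)} {i : ℕ}
    (hrank : Module.finrank K (restrictSupport K {m | m ∈ s ∧ m.degree = i}) +
      Module.finrank K (leadingForms I i) = Module.finrank K (homogeneousSubmodule σ K i))
    (h : restrictSupport K {m | m ∈ s ∧ m.degree = i} ⊓ leadingForms I i = ⊥) :
    homogeneousSubmodule σ K i ≤
      restrictSupport K {m | m ∈ s ∧ m.degree = i} ⊔ leadingForms I i := by
  have hU := restrictSupport_degree_le_homogeneousSubmodule (K := K) s i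
  have hV := leadingForms_le_homogeneousSubmodule I i
  have : FiniteDimensional K (homogeneousSubmodule σ K i) :=
    Module.Finite.iff_fg.2 (homogeneousSubmodule_fg σ K i)
  have := Submodule.finiteDimensional_of_le hU
  have := Submodule.finiteDimensional_of_le hV
  have hsum := Submodule.finrank_sup_add_finrank_inf_eq
    (restrictSupport K {m | m ∈ s ∧ m.degree = i}) (leadingForms I i)
  rw [h, finrank_bot, add_zero, hrank] at hsum
  exact (Submodule.eq_of_le_of_finrank_eq (sup_le hU hV) hsum).ge

lemma restrictSupport_inf_leadingForms_eq_bot {I : Submodule K (MvPolynomial σ K)}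
    {s : Set (σ →₀ ℕ)} {i : ℕ} (hI : I ⊓ restrictSupport K s = ⊥)
    (h : ∀ j < i, homogeneousSubmodule σ K j ≤
      restrictSupport K {m | m ∈ s ∧ m.degree = j} ⊔ leadingForms I j) :
    restrictSupport K {m | m ∈ s ∧ m.degree = i} ⊓ leadingForms I i = ⊥ := by
  refine (Submodule.eq_bot_iff _).2 fun f ⟨hfs, hfI⟩ => ?_
  obtain ⟨p, hpI, hp, hpf⟩ := mem_leadingForms.1 hfI
  have hff : homogeneousComponent i f = f :=
    homogeneousComponent_eq_self (restrictSupport_degree_le_homogeneousSubmodule s i hfs)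
  obtain ⟨q, hqI, hq, hqs⟩ := exists_sub_mem_restrictSupport i h (p - f) (by
    intro k hk
    rcases hk.eq_or_lt with rfl | hk
    · rw [map_sub, hpf, hff, sub_self]
    · rw [map_sub, hp k hk, homogeneousComponent_of_mem
        (restrictSupport_degree_le_homogeneousSubmodule s i hfs), if_neg hk.ne', sub_zero])
  have hpq : p - q = 0 := by
    rw [← Submodule.mem_bot K, ← hI]
    refine ⟨I.sub_mem hpI hqI, ?_⟩
    have := add_mem hqs (restrictSupport_mono K (fun m hm => hm.1) hfs)
    rwa [show p - f - q + f = p - q by abel] at this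
  rw [← hpf, sub_eq_zero.1 hpq, hq i le_rfl]

end MvPolynomial

/-- For a zero-dimensional ideal `I` and an order ideal `O`, the conditions
(a) `|O^{=i}| = dim⟨T^n_{=i}⟩ − dim(I^{≤i}/I^{≤i−1})` for all `i`, and
(b) `⟨O^{=i}⟩ ∩ LF_i(I^{≤i}) = 0` for all `i` (the quotient `I^{≤i}/I^{≤i−1}`
being embedded in `⟨T^n_{=i}⟩` via leading forms), are jointly equivalent to
(a) together with `K[X] = I ⊕ ⟨O⟩`. -/
theorem stmt_10 {K : Type*} [Field K] (n : ℕ)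
    (I : Ideal (MvPolynomial (Fin n) K))
    [FiniteDimensional K (MvPolynomial (Fin n) K ⧸ I)]
    (O : Finset (Fin n →₀ ℕ))
    (hO : ∀ t ∈ O, ∀ t' : Fin n →₀ ℕ, (∀ i, t' i ≤ t i) → t' ∈ O)
    (W : ℕ → Submodule K (MvPolynomial (Fin n) K))
    (hW : ∀ i : ℕ, W i = Submodule.map (homogeneousComponent i)
      (I.restrictScalars K ⊓ restrictTotalDegree (Fin n) K i))
    (OSpan : Submodule K (MvPolynomial (Fin n) K))
    (hOSpan : OSpan =
      Submodule.span K ((fun m => (monomial m (1 : K))) '' (O : Set (Fin n →₀ ℕ))))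
    (OiSpan : ℕ → Submodule K (MvPolynomial (Fin n) K))
    (hOiSpan : ∀ i : ℕ, OiSpan i = Submodule.span K
      ((fun m => (monomial m (1 : K))) ''
        {m : Fin n →₀ ℕ | m ∈ O ∧ m.sum (fun _ e => e) = i})) :
    ((∀ i : ℕ,
        (O.filter (fun m => m.sum (fun _ e => e) = i)).card + Module.finrank K (W i) =
          Module.finrank K (homogeneousSubmodule (Fin n) K i)) ∧
      (∀ i : ℕ, OiSpan i ⊓ W i = ⊥)) ↔
    ((∀ i : ℕ,
        (O.filter (fun m => m.sum (fun _ e => e) = i)).card + Module.finrank K (W i) =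
          Module.finrank K (homogeneousSubmodule (Fin n) K i)) ∧
      (I.restrictScalars K ⊓ OSpan = ⊥ ∧ I.restrictScalars K ⊔ OSpan = ⊤)) := by
  classical
  obtain rfl : W = leadingForms (I.restrictScalars K) := funext hW
  have hOS : OSpan = restrictSupport K (O : Set (Fin n →₀ ℕ)) := by
    rw [hOSpan, restrictSupport_eq_span]
  have hOi : ∀ i, OiSpan i =
      restrictSupport K {m | m ∈ (O : Set (Fin n →₀ ℕ)) ∧ m.degree = i} := fun i => by
    rw [hOiSpan, restrictSupport_eq_span]
    rfl
  have hcard : ∀ i, Module.finrank K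
      (restrictSupport K {m | m ∈ (O : Set (Fin n →₀ ℕ)) ∧ m.degree = i}) =
        (O.filter (fun m => m.sum (fun _ e => e) = i)).card := fun i => by
    rw [← finrank_restrictSupport_coe (K := K), Finset.coe_filter]
    rfl
  simp only [hOi, hOS, ← hcard]
  refine and_congr_right fun ha => ⟨fun hb => ?_, fun hI i => ?_⟩
  · exact ⟨inf_restrictSupport_eq_bot hb,
      sup_restrictSupport_eq_top fun i => homogeneousSubmodule_le_of_inf_eq_bot (ha i) (hb i)⟩
  · induction i using Nat.strong_induction_on with
    | _ i ih =>
      exact restrictSupport_inf_leadingForms_eq_bot hI.1 fun j hj =>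
        homogeneousSubmodule_le_of_inf_eq_bot (ha j) (ih j hj)
end

section
/- With F_{n,k} := {Σ_i i^j x_i : j ∈ [n−k]} ∪ T^n_{=3} in K[x_1,…,x_n] (char K = 0), an order ideal O is a degree-compatible order ideal of (F_{n,k}) supporting a border basis if and only if O^{=1} is a k-element subset of the variables, O^{=2} = {xy : x, y ∈ O^{=1}}, and O^{=ℓ} = ∅ for ℓ ≥ 3 (and 1 ∈ O). -/
open MvPolynomial

/-- The exponents of the monomials of degree at most two in the variables from `S`. -/
noncomputable def quadraticExponents {σ : Type*} (S : Finset σ) : Finset (σ →₀ ℕ) := by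
  classical
  exact insert 0 (S.image (fun i => Finsupp.single i 1) ∪
    Finset.image₂ (fun i j => Finsupp.single i 1 + Finsupp.single j 1) S S)

theorem mem_quadraticExponents {σ : Type*} {S : Finset σ} {m : σ →₀ ℕ} :
    m ∈ quadraticExponents S ↔
      (m = 0 ∨ (∃ i ∈ S, m = Finsupp.single i 1) ∨
        (∃ i ∈ S, ∃ j ∈ S, m = Finsupp.single i 1 + Finsupp.single j 1)) := by
  simp [quadraticExponents, eq_comm]

theorem Finsupp.exists_eq_add_single_of_ne_zero {σ : Type*} {m : σ →₀ ℕ} (hm : m ≠ 0) :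
    ∃ i ∈ m.support, ∃ m' : σ →₀ ℕ, m = m' + Finsupp.single i 1 := by
  obtain ⟨i, hi⟩ := Finsupp.support_nonempty_iff.mpr hm
  obtain ⟨c, hc⟩ := le_iff_exists_add'.mp (show Finsupp.single i 1 ≤ m by
    simp_all; lia)
  exact ⟨i, hi, c, hc⟩

theorem mem_quadraticExponents_iff_degree_le {σ : Type*} {S : Finset σ} {m : σ →₀ ℕ} :
    m ∈ quadraticExponents S ↔ m.degree ≤ 2 ∧ m.support ⊆ S := by
  classical
  rw [mem_quadraticExponents]
  constructor
  · rintro (rfl | ⟨i, hi, rfl⟩ | ⟨i, hi, j, hj, rfl⟩)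
    · simp
    · refine ⟨by simp, Finsupp.support_single_subset.trans (by simpa using hi)⟩
    · refine ⟨by simp, Finsupp.support_add.trans (Finset.union_subset
        (Finsupp.support_single_subset.trans (by simpa using hi))
        (Finsupp.support_single_subset.trans (by simpa using hj)))⟩
  · rintro ⟨hd, hs⟩
    by_cases h0 : m = 0
    · exact Or.inl h0
    obtain ⟨i, hi, m', rfl⟩ := Finsupp.exists_eq_add_single_of_ne_zero h0
    by_cases h1 : m' = 0
    · exact Or.inr (Or.inl ⟨i, hs hi, by simp [h1]⟩)
    obtain ⟨j, hj, m'', rfl⟩ := Finsupp.exists_eq_add_single_of_ne_zero h1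
    have h2 : m'' = 0 := by
      simp only [map_add, Finsupp.degree_single] at hd
      rw [← Finsupp.degree_eq_zero_iff]
      lia
    exact Or.inr (Or.inr ⟨j, hs (by simp), i, hs hi, by simp [h2]⟩)

/-- A homogeneous ideal complemented by the span of a set of monomials has a Hilbert function
determined by these monomials. -/
theorem card_filter_add_finrank_inf_homogeneousSubmodule {K σ : Type*} [Field K] [Finite σ]
    {I : Ideal (MvPolynomial σ K)}
    (hI : ∀ p ∈ I, ∀ i, homogeneousComponent i p ∈ I) (O : Finset (σ →₀ ℕ))
    (hdisj : I.restrictScalars K ⊓ restrictSupport K (O : Set (σ →₀ ℕ)) = ⊥)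
    (hsup : I.restrictScalars K ⊔ restrictSupport K (O : Set (σ →₀ ℕ)) = ⊤) (i : ℕ) :
    (O.filter (fun m => m.degree = i)).card +
        Module.finrank K ↥(I.restrictScalars K ⊓ homogeneousSubmodule σ K i) =
      Module.finrank K (homogeneousSubmodule σ K i) := by
  set T : Finset (σ →₀ ℕ) := O.filter (fun m => m.degree = i) with hT
  have hfin : Module.Finite K (homogeneousSubmodule σ K i) :=
    Module.Finite.iff_fg.mpr (homogeneousSubmodule_fg σ K i)
  have hTle : restrictSupport K (T : Set (σ →₀ ℕ)) ≤ homogeneousSubmodule σ K i := by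
    intro p hp
    rw [p.as_sum]
    exact sum_mem fun d hd => isHomogeneous_monomial _
      (Finset.mem_filter.mp ((mem_restrictSupport_iff K).mp hp hd)).2
  have hcard : Module.finrank K (restrictSupport K (T : Set (σ →₀ ℕ))) = T.card := by
    rw [Module.finrank_eq_card_basis (basisRestrictSupport K (T : Set (σ →₀ ℕ)))]
    simp
  have h1 : (I.restrictScalars K ⊓ homogeneousSubmodule σ K i) ⊔
      restrictSupport K (T : Set (σ →₀ ℕ)) = homogeneousSubmodule σ K i := by
    refine le_antisymm (sup_le inf_le_right hTle) fun p hp => ?_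
    have hp' : p ∈ I.restrictScalars K ⊔ restrictSupport K (O : Set (σ →₀ ℕ)) := by
      rw [hsup]; trivial
    obtain ⟨a, ha, b, hb, rfl⟩ := Submodule.mem_sup.mp hp'
    rw [← homogeneousComponent_eq_self hp, map_add]
    refine Submodule.add_mem_sup ⟨hI a ha i, homogeneousComponent_mem i a⟩ ?_
    rw [mem_restrictSupport_iff] at hb ⊢
    intro d hd
    rw [Finset.mem_coe, mem_support_iff, coeff_homogeneousComponent] at hd
    simp only [ne_eq, ite_eq_right_iff, Classical.not_imp] at hd
    simpa [hT] using ⟨hb (by simpa using hd.2), hd.1⟩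
  have h2 : (I.restrictScalars K ⊓ homogeneousSubmodule σ K i) ⊓
      restrictSupport K (T : Set (σ →₀ ℕ)) = ⊥ := by
    rw [eq_bot_iff, ← hdisj]
    exact inf_le_inf inf_le_left (restrictSupport_mono _ (Finset.coe_subset.mpr (Finset.filter_subset _ _)))
  have hfin1 : Module.Finite K ↥(I.restrictScalars K ⊓ homogeneousSubmodule σ K i) :=
    Submodule.finiteDimensional_of_le inf_le_right
  have hfin2 : Module.Finite K (restrictSupport K (T : Set (σ →₀ ℕ))) :=
    Submodule.finiteDimensional_of_le hTle
  have := Submodule.finrank_sup_add_finrank_inf_eq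
    (I.restrictScalars K ⊓ homogeneousSubmodule σ K i) (restrictSupport K (T : Set (σ →₀ ℕ)))
  rw [h1, h2, finrank_bot, hcard] at this
  lia

theorem map_homogeneousComponent_inf_restrictTotalDegree {K σ : Type*} [Field K]
    {I : Ideal (MvPolynomial σ K)}
    (hI : ∀ p ∈ I, ∀ i, homogeneousComponent i p ∈ I) (i : ℕ) :
    Submodule.map (homogeneousComponent i)
        (I.restrictScalars K ⊓ restrictTotalDegree σ K i) =
      I.restrictScalars K ⊓ homogeneousSubmodule σ K i := by
  ext p
  constructor
  · rintro ⟨q, hq, rfl⟩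
    exact ⟨hI q hq.1 i, homogeneousComponent_mem i q⟩
  · rintro ⟨hp, hd⟩
    exact ⟨p, ⟨hp, (mem_restrictTotalDegree _ _ _).mpr (IsHomogeneous.totalDegree_le hd)⟩,
      homogeneousComponent_eq_self hd⟩

/-- A matrix with an invertible set of columns has a right inverse supported on the
corresponding rows, which is a left inverse modulo the other columns. -/
theorem exists_right_inverse_supported {K ι κ : Type*} [Field K] [Fintype ι] [DecidableEq ι]
    [Fintype κ] [DecidableEq κ] (A : Matrix κ ι K) (S : Finset ι) (e : κ ≃ {i // i ∉ S})
    (hdet : (A.submatrix id (fun j => (e j : ι))).det ≠ 0) :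
    ∃ C : Matrix ι κ K, (∀ i ∈ S, ∀ j, C i j = 0) ∧ A * C = 1 ∧
      ∀ i ∉ S, ∀ i' ∉ S, (C * A) i i' = (1 : Matrix ι ι K) i i' := by
  set B := A.submatrix id (fun j => (e j : ι)) with hB
  have hu : IsUnit B.det := isUnit_iff_ne_zero.mpr hdet
  refine ⟨Matrix.of fun i j => if h : i ∉ S then B⁻¹ (e.symm ⟨i, h⟩) j else 0, ?_, ?_, ?_⟩
  · intro i hi j
    simp [hi]
  · rw [← Matrix.mul_nonsing_inv B hu]
    ext j j'
    simp only [Matrix.mul_apply]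
    rw [← Finset.sum_subset (Finset.subset_univ (Finset.univ.filter (fun i => i ∉ S)))]
    · rw [Finset.sum_subtype (p := fun i => i ∉ S) _ (by simp)]
      refine (Fintype.sum_equiv e _ _ fun j₁ => ?_).symm
      simp [hB, (e j₁).2]
    · intro i _ hi
      have : i ∈ S := by simpa using hi
      simp [this]
  · intro i hi i' hi'
    have := congrFun (congrFun (Matrix.nonsing_inv_mul B hu) (e.symm ⟨i, hi⟩)) (e.symm ⟨i', hi'⟩)
    simp only [Matrix.mul_apply, hB, Matrix.submatrix_apply, id, Equiv.apply_symm_apply,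
      Matrix.one_apply, EmbeddingLike.apply_eq_iff_eq, Subtype.mk.injEq] at this
    simpa [Matrix.mul_apply, hi, Matrix.one_apply, hB] using this

theorem det_pow_succ_ne_zero {K : Type*} [Field K] {r : ℕ} (a : Fin r → K)
    (ha : Function.Injective a) (ha0 : ∀ i, a i ≠ 0) :
    (Matrix.of fun j i : Fin r => a i ^ ((j : ℕ) + 1)).det ≠ 0 := by
  have : (Matrix.of fun j i : Fin r => a i ^ ((j : ℕ) + 1)) =
      Matrix.of fun j i => a i * (Matrix.vandermonde a).transpose j i := by
    ext j i
    simp [Matrix.vandermonde_apply, pow_succ']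
  rw [this, Matrix.det_mul_row, Matrix.det_transpose]
  exact mul_ne_zero (Finset.prod_ne_zero_iff.mpr fun i _ => ha0 i)
    (Matrix.det_vandermonde_ne_zero_iff.mpr ha)

/-- The span of linear forms and of all cubic monomials is complemented by the monomials of degree
at most two in a set of variables modulo which the linear forms are a basis. -/
theorem isCompl_restrictSupport_quadraticExponents {K ι κ : Type*} [Field K] [Fintype ι]
    [DecidableEq ι] [Fintype κ] [DecidableEq κ] (A : Matrix κ ι K) (S : Finset ι)
    (e : κ ≃ {i // i ∉ S}) (hdet : (A.submatrix id (fun j => (e j : ι))).det ≠ 0)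
    (v : κ → MvPolynomial ι K) (hv : ∀ j, v j = ∑ i, A j i • X i) :
    IsCompl ((Ideal.span (Set.range v) ⊔ idealOfVars ι K ^ 3).restrictScalars K)
      (restrictSupport K (quadraticExponents S : Set (ι →₀ ℕ))) := by
  obtain ⟨C, hC0, hAC, hCA⟩ := exists_right_inverse_supported A S e hdet
  set I := Ideal.span (Set.range v) ⊔ idealOfVars ι K ^ 3
  have hvI : ∀ j, v j ∈ I := fun j =>
    Ideal.mem_sup_left (Ideal.subset_span (Set.mem_range_self j))
  set ℓ : ι → MvPolynomial ι K := fun i => X i - ∑ j, C i j • v j with hℓ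
  set φ : MvPolynomial ι K →ₐ[K] MvPolynomial ι K := aeval ℓ with hφ
  have hφS : ∀ i ∈ S, ℓ i = X i := fun i hi => by simp [hℓ, hC0 i hi]
  have hℓ' : ∀ i, ℓ i = ∑ i', ((1 : Matrix ι ι K) - C * A) i i' • X i' := by
    intro i
    simp only [hℓ, hv, Matrix.sub_apply, sub_smul, Finset.sum_sub_distrib, Matrix.one_apply,
      ite_smul, one_smul, zero_smul, Finset.sum_ite_eq, Finset.mem_univ, if_true,
      Matrix.mul_apply, Finset.sum_smul, Finset.smul_sum, smul_smul]
    rw [Finset.sum_comm]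
  have hsupp : ∀ p, φ p ∈ supported K (S : Set ι) := by
    intro p
    have hle : (aeval ℓ : MvPolynomial ι K →ₐ[K] MvPolynomial ι K).range ≤
        supported K (S : Set ι) := by
      rw [← Algebra.adjoin_range_eq_range_aeval, Algebra.adjoin_le_iff]
      rintro _ ⟨i, rfl⟩
      by_cases hi : i ∈ S
      · simp only [SetLike.mem_coe, hφS i hi]
        exact X_mem_supported.mpr hi
      · simp only [SetLike.mem_coe, hℓ']
        refine sum_mem fun i' _ => ?_
        by_cases hi' : i' ∈ S
        · exact Subalgebra.smul_mem _ (X_mem_supported.mpr hi') _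
        · simp [hCA i hi i' hi']
    exact hle ⟨p, rfl⟩
  have hℓhom : ∀ i, ℓ i ∈ idealOfVars ι K := by
    intro i
    rw [hℓ']
    refine sum_mem fun i' _ => Submodule.smul_of_tower_mem _ _ ?_
    exact Ideal.subset_span (Set.mem_range_self i')
  have hφv : ∀ j, φ (v j) = 0 := by
    intro j
    have : φ (v j) = v j - ∑ j', (A * C) j j' • v j' := by
      rw [hv j, map_sum]
      simp only [map_smul, hφ, aeval_X, hℓ, smul_sub, Finset.sum_sub_distrib, Finset.smul_sum,
        smul_smul, Matrix.mul_apply, Finset.sum_smul]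
      rw [Finset.sum_comm]
    rw [this, hAC]
    simp [Matrix.one_apply]
  have hmod : ∀ p, p - φ p ∈ I := by
    intro p
    have : (Ideal.Quotient.mkₐ K I).comp φ = Ideal.Quotient.mkₐ K I := by
      refine algHom_ext fun i => ?_
      simp only [AlgHom.comp_apply, hφ, aeval_X]
      refine Ideal.Quotient.eq.mpr ?_
      have : ℓ i - X i = - ∑ j, C i j • v j := by simp [hℓ]
      rw [this]
      exact neg_mem (sum_mem fun j _ => Submodule.smul_of_tower_mem _ _ (hvI j))
    exact Ideal.Quotient.eq.mp (DFunLike.congr_fun this p).symm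
  have hφI : ∀ p ∈ I, φ p ∈ idealOfVars ι K ^ 3 := by
    have : I ≤ (idealOfVars ι K ^ 3).comap φ := by
      refine sup_le (Ideal.span_le.mpr ?_) ?_
      · rintro _ ⟨j, rfl⟩
        simp [hφv]
      · rw [← Ideal.map_le_iff_le_comap, Ideal.map_pow]
        refine Ideal.pow_right_mono (Ideal.map_le_iff_le_comap.mpr (Ideal.span_le.mpr ?_)) 3
        rintro _ ⟨i, rfl⟩
        simpa [hφ] using hℓhom i
    exact fun p hp => this hp
  have hfix : ∀ p ∈ restrictSupport K (quadraticExponents S : Set (ι →₀ ℕ)), φ p = p := by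
    intro p hp
    conv_rhs => rw [← aeval_X_left_apply p]
    refine hom_congr_vars (by ext; simp) (fun i hi _ => ?_) rfl
    obtain ⟨m, hm, him⟩ := (mem_vars_iff_mem_support i).mp hi
    simpa [hφ] using hφS i ((mem_quadraticExponents_iff_degree_le.mp (hp hm)).2 him)
  constructor
  · rw [Submodule.disjoint_def]
    intro p hp hpO
    have h3 := hφI p hp
    rw [hfix p hpO, mem_pow_idealOfVars_iff] at h3
    rw [← support_eq_empty, Finset.eq_empty_iff_forall_notMem]
    intro m hm
    have := (mem_quadraticExponents_iff_degree_le.mp (hpO hm)).1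
    have := h3 m hm
    lia
  · rw [codisjoint_iff, eq_top_iff]
    intro p _
    have h : ∀ m ∈ (φ p).support, monomial m (coeff m (φ p)) ∈ I.restrictScalars K ⊔
        restrictSupport K (quadraticExponents S : Set (ι →₀ ℕ)) := by
      intro m hm
      by_cases hd : m.degree ≤ 2
      · refine Submodule.mem_sup_right ((monomial_mem_restrictSupport K).mpr (Or.inl ?_))
        refine mem_quadraticExponents_iff_degree_le.mpr ⟨hd, fun i hi => ?_⟩
        exact mem_supported.mp (hsupp p) ((mem_vars_iff_mem_support i).mpr ⟨m, hm, hi⟩)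
      · refine Submodule.mem_sup_left (Ideal.mem_sup_right ?_)
        rw [monomial_mem_pow_idealOfVars_iff 3 m (mem_support_iff.mp hm)]
        lia
    rw [← sub_add_cancel p (φ p)]
    refine add_mem (Submodule.mem_sup_left (hmod p)) ?_
    rw [(φ p).as_sum]
    exact sum_mem h

/-- With `F_{n,k} = {Σ_i i^j x_i : j ∈ [n−k]} ∪ T^n_{=3}` and
`I = (F_{n,k})`, an order ideal `O` is a degree-compatible order ideal of `I`
supporting a border basis if and only if `1 ∈ O`, `O^{=1}` consists of `k`
variables, `O^{=2}` consists of all products of two of these variables and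
`O^{=ℓ} = ∅` for `ℓ ≥ 3`. -/
theorem stmt_18 {K : Type*} [Field K] [CharZero K] (n k : ℕ)
    (hk : 1 ≤ k) (hkn : k ≤ n)
    (v : Fin (n - k) → MvPolynomial (Fin n) K)
    (hv : ∀ j : Fin (n - k),
      v j = ∑ i : Fin n, (((i : ℕ) + 1 : K) ^ ((j : ℕ) + 1)) • X i)
    (F : Set (MvPolynomial (Fin n) K))
    (hF : F = Set.range v ∪
      {p : MvPolynomial (Fin n) K |
        ∃ m : Fin n →₀ ℕ, m.sum (fun _ e => e) = 3 ∧ p = monomial m (1 : K)})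
    (I : Ideal (MvPolynomial (Fin n) K)) (hI : I = Ideal.span F)
    (W : ℕ → Submodule K (MvPolynomial (Fin n) K))
    (hW : ∀ i : ℕ, W i = Submodule.map (homogeneousComponent i)
      (I.restrictScalars K ⊓ restrictTotalDegree (Fin n) K i))
    (O : Finset (Fin n →₀ ℕ))
    (hOideal : ∀ t ∈ O, ∀ t' : Fin n →₀ ℕ, (∀ i, t' i ≤ t i) → t' ∈ O) :
    ((∀ i : ℕ,
        (O.filter (fun m => m.sum (fun _ e => e) = i)).card + Module.finrank K (W i) =
          Module.finrank K (homogeneousSubmodule (Fin n) K i)) ∧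
      I.restrictScalars K ⊓
          Submodule.span K ((fun m => (monomial m (1 : K))) '' (O : Set (Fin n →₀ ℕ))) = ⊥ ∧
      I.restrictScalars K ⊔
          Submodule.span K ((fun m => (monomial m (1 : K))) '' (O : Set (Fin n →₀ ℕ))) = ⊤)
    ↔
    (∃ S : Finset (Fin n), S.card = k ∧
      ∀ m : Fin n →₀ ℕ, m ∈ O ↔
        (m = 0 ∨ (∃ i ∈ S, m = Finsupp.single i 1) ∨
          (∃ i ∈ S, ∃ j ∈ S, m = Finsupp.single i 1 + Finsupp.single j 1))) := by
  classical
  have hI' : I = Ideal.span (Set.range v) ⊔ idealOfVars (Fin n) K ^ 3 := by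
    rw [hI, hF, Ideal.span_union, pow_idealOfVars_eq_span]
    congr 2
    ext p
    exact exists_congr fun m => and_congr Iff.rfl eq_comm
  have hvhom : ∀ j, (v j).IsHomogeneous 1 := by
    intro j
    rw [hv]
    exact sum_mem (S := homogeneousSubmodule (Fin n) K 1)
      fun i _ => Submodule.smul_mem _ _ (isHomogeneous_X K i)
  have hIhom : ∀ p ∈ I, ∀ i, homogeneousComponent i p ∈ I := by
    let := MvPolynomial.gradedAlgebra (R := K) (σ := Fin n)
    have : I.IsHomogeneous (homogeneousSubmodule (Fin n) K) := by
      rw [hI]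
      refine Ideal.homogeneous_span _ _ ?_
      rw [hF]
      rintro _ (⟨j, rfl⟩ | ⟨m, hm, rfl⟩)
      · exact ⟨1, hvhom j⟩
      · exact ⟨3, isHomogeneous_monomial 1 hm⟩
    exact fun p hp i => homogeneousComponent_mem_of_mem this hp i
  have hW' : ∀ i, W i = I.restrictScalars K ⊓ homogeneousSubmodule (Fin n) K i := fun i => by
    rw [hW, map_homogeneousComponent_inf_restrictTotalDegree hIhom]
  have hcompl : ∀ S : Finset (Fin n), S.card = k → IsCompl (I.restrictScalars K)
      (restrictSupport K (quadraticExponents S : Set (Fin n →₀ ℕ))) := by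
    intro S hS
    have hcard : Fintype.card (Fin (n - k)) = Fintype.card {i // i ∉ S} := by
      simp [Fintype.card_subtype_compl, hS]
    have e := Fintype.equivOfCardEq hcard
    rw [hI']
    refine isCompl_restrictSupport_quadraticExponents
      (Matrix.of fun (j : Fin (n - k)) (i : Fin n) => (((i : ℕ) + 1 : K) ^ ((j : ℕ) + 1))) S e ?_ v hv
    refine det_pow_succ_ne_zero (fun j => ((((e j : Fin n) : ℕ) : K) + 1)) ?_ ?_
    · intro j j' h
      simpa [Fin.val_inj, Subtype.val_inj] using h
    · intro j
      exact Nat.cast_add_one_ne_zero _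
  have hdim : ∀ S : Finset (Fin n), S.card = k → ∀ i : ℕ,
      ((quadraticExponents S).filter (fun m => m.degree = i)).card + Module.finrank K (W i) =
        Module.finrank K (homogeneousSubmodule (Fin n) K i) := by
    intro S hS i
    rw [hW']
    exact card_filter_add_finrank_inf_homogeneousSubmodule hIhom _ (hcompl S hS).inf_eq_bot
      (hcompl S hS).sup_eq_top i
  rw [← restrictSupport_eq_span]
  simp only [← mem_quadraticExponents]
  constructor
  · rintro ⟨hO, -, -⟩
    have hcard : ∀ S : Finset (Fin n), S.card = k → ∀ i : ℕ,
        (O.filter (fun m => m.degree = i)).card =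
          ((quadraticExponents S).filter (fun m => m.degree = i)).card := by
      intro S hS i
      exact Nat.add_right_cancel ((hO i).trans (hdim S hS i).symm)
    have hdeg1 : ∀ P : Finset (Fin n →₀ ℕ), (P.filter (fun m => m.degree = 1)).card =
        (Finset.univ.filter (fun i => Finsupp.single i 1 ∈ P)).card := by
      intro P
      symm
      refine Finset.card_bij (fun i _ => Finsupp.single i 1) ?_ ?_ ?_
      · simp
      · intro i _ j _ h
        exact Finsupp.single_left_injective one_ne_zero h
      · intro m hm
        obtain ⟨hmP, hm1⟩ := Finset.mem_filter.mp hm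
        obtain ⟨i, -, m', rfl⟩ := Finsupp.exists_eq_add_single_of_ne_zero
          (show m ≠ 0 by rintro rfl; simp at hm1)
        obtain rfl : m' = 0 := (Finsupp.degree_eq_zero_iff m').mp (by simpa using hm1)
        rw [zero_add] at hmP ⊢
        exact ⟨i, by simpa using hmP, rfl⟩
    obtain ⟨S₀, -, hS₀⟩ := Finset.exists_subset_card_eq
      (s := (Finset.univ : Finset (Fin n))) (n := k) (by simpa using hkn)
    have hS : (Finset.univ.filter (fun i => Finsupp.single i 1 ∈ O)).card = k := by
      rw [← hdeg1, hcard S₀ hS₀, hdeg1, ← hS₀]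
      congr 1
      ext i
      simp [mem_quadraticExponents_iff_degree_le]
    refine ⟨_, hS, ?_⟩
    set S := Finset.univ.filter (fun i => Finsupp.single i 1 ∈ O) with hSdef
    have hsub : O ⊆ quadraticExponents S := by
      intro m hm
      rw [mem_quadraticExponents_iff_degree_le]
      constructor
      · by_contra hd
        have : 0 < (O.filter (fun m' => m'.degree = m.degree)).card :=
          Finset.card_pos.mpr ⟨m, by simp [hm]⟩
        rw [hcard S hS, Finset.card_pos] at this
        obtain ⟨m', hm'⟩ := this
        obtain ⟨h1, h2⟩ := Finset.mem_filter.mp hm'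
        exact hd (h2 ▸ (mem_quadraticExponents_iff_degree_le.mp h1).1)
      · intro i hi
        refine Finset.mem_filter.mpr ⟨Finset.mem_univ i, hOideal m hm _ fun j => ?_⟩
        rw [Finsupp.single_apply]
        split_ifs with h
        · subst h
          exact Nat.one_le_iff_ne_zero.mpr (Finsupp.mem_support_iff.mp hi)
        · exact Nat.zero_le _
    intro m
    refine ⟨fun hm => hsub hm, fun hm => ?_⟩
    have := Finset.eq_of_subset_of_card_le
      (Finset.filter_subset_filter (fun m' : Fin n →₀ ℕ => m'.degree = m.degree) hsub)
      (hcard S hS m.degree).ge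
    have hm' : m ∈ O.filter (fun m' => m'.degree = m.degree) := by
      rw [this]
      simp [hm]
    exact (Finset.mem_filter.mp hm').1
  · rintro ⟨S, hS, hOS⟩
    obtain rfl : O = quadraticExponents S := Finset.ext hOS
    exact ⟨hdim S hS, (hcompl S hS).inf_eq_bot, (hcompl S hS).sup_eq_top⟩
end
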